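/- The minimum min{ M_α(G) : G ∈ Path[x,b] } is attained by some allocation path, and it equals min{ d_α(Σ_{i=1}^k m_i δ_{x_i}, b) : (m_1,…,m_k) ∈ K }, where K = {(m_1,…,m_k) ∈ ℝ_{≥0}^k : Σ_{i=1}^k m_i = 1} and atoms with m_i = 0 are omitted from the measure Σ_{i=1}^k m_i δ_{x_i}; in particular the latter minimum over the simplex K is also attained. -/

import Mathlib

open scoped BigOperators RealInnerProductSpace

noncomputable section

attribute [local instance] Classical.propDecidable

/-- Points of the ambient Euclidean space `ℝ^m`. -/
abbrev Pt (m : ℕ) := EuclideanSpace ℝ (Fin m)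

/-- A weighted directed graph in `ℝ^m`: a finite vertex set, a finite set of
directed edges (ordered pairs of points, viewed as directed line segments), and
a weight function. -/
structure WDG (m : ℕ) where
  V : Finset (Pt m)
  E : Finset (Pt m × Pt m)
  w : Pt m × Pt m → ℝ

namespace WDG

variable {m : ℕ}

/-- Edges join distinct vertices of the graph and carry positive weight. -/
def edgesOK (G : WDG m) : Prop :=
  ∀ e ∈ G.E, e.1 ∈ G.V ∧ e.2 ∈ G.V ∧ e.1 ≠ e.2 ∧ 0 < G.w e

/-- The underlying undirected (simple) graph. -/
def undirected (G : WDG m) : SimpleGraph (Pt m) :=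
  SimpleGraph.fromRel (fun u v => (u, v) ∈ G.E)

/-- The cost `M_α(G) = Σ_{e ∈ E(G)} w(e)^α · length(e)`. -/
def cost (α : ℝ) (G : WDG m) : ℝ :=
  ∑ e ∈ G.E, (G.w e) ^ α * dist e.1 e.2

/-- Total weight of edges starting at `v`. -/
def outflow (G : WDG m) (v : Pt m) : ℝ :=
  ∑ e ∈ G.E.filter (fun e => e.1 = v), G.w e

/-- Total weight of edges ending at `v`. -/
def inflow (G : WDG m) (v : Pt m) : ℝ :=
  ∑ e ∈ G.E.filter (fun e => e.2 = v), G.w e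

end WDG

/-- Atomic measures are represented as finitely supported functions `ℝ^m →₀ ℝ`
with nonnegative values; `AtomicOn X c` also requires the atoms to lie in `X`. -/
def AtomicOn {m : ℕ} (X : Set (Pt m)) (c : Pt m →₀ ℝ) : Prop :=
  (∀ z, 0 ≤ c z) ∧ ↑c.support ⊆ X

/-- The mass `m(c)` of an atomic measure. -/
def massOf {m : ℕ} (c : Pt m →₀ ℝ) : ℝ := c.sum fun _ t => t

/-- `G` is a transport path from `a` to `b` inside `X`: its vertices lie in `X`
and contain the atoms of `a` and `b`, its underlying undirected graph has no
cycles, and the balance equation holds at every vertex. -/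
def IsTransportPath {m : ℕ} (X : Set (Pt m)) (G : WDG m) (a b : Pt m →₀ ℝ) : Prop :=
  G.edgesOK ∧ ↑G.V ⊆ X ∧
  (∀ z ∈ a.support, z ∈ G.V) ∧ (∀ z ∈ b.support, z ∈ G.V) ∧
  G.undirected.IsAcyclic ∧
  ∀ v : Pt m, G.outflow v - G.inflow v = a v - b v

/-- `d_α(a,b)`: the minimal cost of a transport path from `a` to `b`. -/
def dCost {m : ℕ} (X : Set (Pt m)) (α : ℝ) (a b : Pt m →₀ ℝ) : ℝ :=
  sInf (WDG.cost α '' {G : WDG m | IsTransportPath X G a b})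

/-- An optimal transport path from `a` to `b`. -/
def IsOptimalTP {m : ℕ} (X : Set (Pt m)) (α : ℝ) (G : WDG m) (a b : Pt m →₀ ℝ) : Prop :=
  IsTransportPath X G a b ∧
    ∀ G' : WDG m, IsTransportPath X G' a b → WDG.cost α G ≤ WDG.cost α G'

/-- The atomic probability measure `b = Σ_j n_j δ_{y_j}` of households. -/
def bMeas {m ℓ : ℕ} (y : Fin ℓ → Pt m) (n : Fin ℓ → ℝ) : Pt m →₀ ℝ :=
  ∑ j, Finsupp.single (y j) (n j)

/-- An allocation path from the factory locations `x` to the households `(y,n)`: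
a transport path to `b` from some atomic probability measure supported on the
factory locations. -/
def IsAllocPath {m k ℓ : ℕ} (X : Set (Pt m)) (x : Fin k → Pt m)
    (y : Fin ℓ → Pt m) (n : Fin ℓ → ℝ) (G : WDG m) : Prop :=
  ∃ a : Pt m →₀ ℝ, (∀ z, 0 ≤ a z) ∧ ↑a.support ⊆ Set.range x ∧ massOf a = 1 ∧
    IsTransportPath X G a (bMeas y n)

/-- An optimal allocation path: it minimizes `M_α` over all allocation paths. -/
def IsOptimalAllocPath {m k ℓ : ℕ} (X : Set (Pt m)) (α : ℝ) (x : Fin k → Pt m)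
    (y : Fin ℓ → Pt m) (n : Fin ℓ → ℝ) (G : WDG m) : Prop :=
  IsAllocPath X x y n G ∧
    ∀ G' : WDG m, IsAllocPath X x y n G' → WDG.cost α G ≤ WDG.cost α G'

/-- For an assignment map `S`, the part `b_i = Σ_{j : S(j) = i} n_j δ_{y_j}`. -/
def bPart {m k ℓ : ℕ} (y : Fin ℓ → Pt m) (n : Fin ℓ → ℝ) (S : Fin ℓ → Fin k)
    (i : Fin k) : Pt m →₀ ℝ :=
  ∑ j ∈ Finset.univ.filter (fun j => S j = i), Finsupp.single (y j) (n j)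

/-- The mass `m(b_i) = Σ_{j : S(j) = i} n_j`. -/
def mB {k ℓ : ℕ} (n : Fin ℓ → ℝ) (S : Fin ℓ → Fin k) (i : Fin k) : ℝ :=
  ∑ j ∈ Finset.univ.filter (fun j => S j = i), n j

/-- `E_α(S) = Σ_i d_α(m(b_i) δ_{x_i}, b_i)`. -/
def Ealpha {m k ℓ : ℕ} (X : Set (Pt m)) (α : ℝ) (x : Fin k → Pt m)
    (y : Fin ℓ → Pt m) (n : Fin ℓ → ℝ) (S : Fin ℓ → Fin k) : ℝ :=
  ∑ i, dCost X α (Finsupp.single (x i) (mB n S i)) (bPart y n S i)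

/-- An optimal assignment map minimizes `E_α` over all assignment maps. -/
def IsOptimalAssign {m k ℓ : ℕ} (X : Set (Pt m)) (α : ℝ) (x : Fin k → Pt m)
    (y : Fin ℓ → Pt m) (n : Fin ℓ → ℝ) (S : Fin ℓ → Fin k) : Prop :=
  ∀ S' : Fin ℓ → Fin k, Ealpha X α x y n S ≤ Ealpha X α x y n S'

/-- `ρ_α(σ,ε)`: equals `(σ/ε)^α − (σ/ε − 1)^α` for `σ > ε` (and for `σ = ε` when
`α ∈ (0,1)`), and equals `1` when `σ = ε` (covering also the convention for `α = 0`). -/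
def rho (α σ ε : ℝ) : ℝ :=
  if σ = ε then 1 else (σ / ε) ^ α - (σ / ε - 1) ^ α


/-- `G` is the disjoint union of the subgraphs `Gi`: the `Gi` have pairwise
disjoint vertex sets, each is a subgraph of `G` (with matching weights), and
the edges of `G` are exactly the (disjoint) union of their edges. -/
def IsDisjointUnion {m k : ℕ} (G : WDG m) (Gi : Fin k → WDG m) : Prop :=
  (∀ i i' : Fin k, i ≠ i' → Disjoint (Gi i).V (Gi i').V) ∧
  (∀ i, (Gi i).V ⊆ G.V) ∧
  (∀ i, (Gi i).E ⊆ G.E) ∧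
  (∀ i, ∀ e ∈ (Gi i).E, (Gi i).w e = G.w e) ∧
  G.E = Finset.univ.biUnion (fun i => (Gi i).E)

/-- The projection coordinate `π(z) = ⟨z − p, v⟩` along the line through `p`
in direction `v`. -/
def proj {m : ℕ} (p v z : Pt m) : ℝ := ⟪z - p, v⟫

/-- The constant `C = √(m−1)/(2^{1−(m−1)(1−α)} − 1) + 1`. -/
def Cconst (m : ℕ) (α : ℝ) : ℝ :=
  Real.sqrt ((m : ℝ) - 1) / ((2 : ℝ) ^ (1 - ((m : ℝ) - 1) * (1 - α)) - 1) + 1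


section Flow

variable {W : Type*}

/-- The divergence (outflow minus inflow) of a finitely supported flow on ordered pairs. -/
def divergence : (W × W →₀ ℝ) →ₗ[ℝ] (W →₀ ℝ) :=
  Finsupp.lmapDomain ℝ ℝ Prod.fst - Finsupp.lmapDomain ℝ ℝ Prod.snd

/-- The cost of a flow with respect to the edge lengths `L`. -/
def flowCost (α : ℝ) (L : W × W → ℝ) (f : W × W →₀ ℝ) : ℝ :=
  ∑ e ∈ f.support, (f e) ^ α * L e

lemma divergence_single (u v : W) (t : ℝ) :
    divergence (Finsupp.single (u, v) t) = Finsupp.single u t - Finsupp.single v t := by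
  simp [divergence, Finsupp.mapDomain_single]

lemma mapDomain_apply_eq_sum_filter {β γ : Type*} (p : β → γ) (f : β →₀ ℝ) (c : γ) :
    Finsupp.mapDomain p f c = ∑ e ∈ f.support.filter (fun e => p e = c), f e := by
  rw [Finsupp.mapDomain, Finsupp.sum_apply, Finsupp.sum, Finset.sum_filter]
  exact Finset.sum_congr rfl fun e _ => by rw [Finsupp.single_apply]

lemma divergence_apply (f : W × W →₀ ℝ) (v : W) :
    divergence f v = ∑ e ∈ f.support.filter (fun e => e.1 = v), f e -
      ∑ e ∈ f.support.filter (fun e => e.2 = v), f e := by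
  simp only [divergence, LinearMap.sub_apply, Finsupp.lmapDomain_apply, Finsupp.sub_apply,
    mapDomain_apply_eq_sum_filter]

lemma divergence_apply_eq_zero (f : W × W →₀ ℝ) {v : W}
    (hv : ∀ e ∈ f.support, e.1 ≠ v ∧ e.2 ≠ v) : divergence f v = 0 := by
  rw [divergence_apply, Finset.filter_false_of_mem fun e he => (hv e he).1,
    Finset.filter_false_of_mem fun e he => (hv e he).2]
  simp

lemma sum_divergence (f : W × W →₀ ℝ) {A : Finset W}
    (hA : ∀ e ∈ f.support, e.1 ∈ A ∧ e.2 ∈ A) : ∑ v ∈ A, divergence f v = 0 := by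
  simp only [divergence_apply, Finset.sum_sub_distrib]
  rw [Finset.sum_fiberwise_of_maps_to fun e he => (hA e he).1,
    Finset.sum_fiberwise_of_maps_to fun e he => (hA e he).2, sub_self]

lemma flowCost_nonneg {α : ℝ} {L : W × W → ℝ} (hL : ∀ e, 0 ≤ L e) {f : W × W →₀ ℝ}
    (hf : ∀ e, 0 ≤ f e) : 0 ≤ flowCost α L f :=
  Finset.sum_nonneg fun e _ => mul_nonneg (Real.rpow_nonneg (hf e) _) (hL e)

lemma flowCost_le_sum {α : ℝ} {L : W × W → ℝ} (hL : ∀ e, 0 ≤ L e) {f : W × W →₀ ℝ}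
    (hf : ∀ e, 0 ≤ f e) {A : Finset (W × W)} (hA : f.support ⊆ A) :
    flowCost α L f ≤ ∑ e ∈ A, (f e) ^ α * L e :=
  Finset.sum_le_sum_of_subset_of_nonneg hA
    fun e _ _ => mul_nonneg (Real.rpow_nonneg (hf e) _) (hL e)

lemma flowCost_single_le {α : ℝ} {L : W × W → ℝ} (hL : ∀ e, 0 ≤ L e) (e : W × W) {t : ℝ}
    (ht : 0 ≤ t) : flowCost α L (Finsupp.single e t) ≤ t ^ α * L e := by
  refine (flowCost_le_sum hL (fun e' => ?_) Finsupp.support_single_subset).trans_eq ?_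
  · rw [Finsupp.single_apply]; split_ifs <;> simp [ht]
  · simp

lemma flowCost_add_le {α : ℝ} (hα0 : 0 ≤ α) (hα1 : α ≤ 1) {L : W × W → ℝ} (hL : ∀ e, 0 ≤ L e)
    {f g : W × W →₀ ℝ} (hf : ∀ e, 0 ≤ f e) (hg : ∀ e, 0 ≤ g e) :
    flowCost α L (f + g) ≤ flowCost α L f + flowCost α L g := by
  have key : ∀ e ∈ f.support ∪ g.support, ((f + g) e) ^ α * L e ≤
      (if e ∈ f.support then (f e) ^ α * L e else 0) +
        (if e ∈ g.support then (g e) ^ α * L e else 0) := by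
    intro e he
    have hadd := Real.rpow_add_le_add_rpow (hf e) (hg e) hα0 hα1
    have := mul_le_mul_of_nonneg_right hadd (hL e)
    by_cases h1 : f e = 0 <;> by_cases h2 : g e = 0
    · simp [h1, h2] at he
    · simp [h1, h2]
    · simp [h1, h2]
    · simpa [h1, h2, add_mul] using this
  refine (flowCost_le_sum hL (fun e => add_nonneg (hf e) (hg e)) Finsupp.support_add).trans
    ((Finset.sum_le_sum key).trans_eq ?_)
  rw [Finset.sum_add_distrib, ← Finset.sum_filter, ← Finset.sum_filter]
  congr 1
  · exact Finset.sum_congr (by ext; simp +contextual) fun _ _ => rfl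
  · exact Finset.sum_congr (by ext; simp +contextual) fun _ _ => rfl

lemma flowCost_sum_le {ι : Type*} {α : ℝ} (hα0 : 0 ≤ α) (hα1 : α ≤ 1) {L : W × W → ℝ}
    (hL : ∀ e, 0 ≤ L e) (s : Finset ι) {f : ι → W × W →₀ ℝ} (hf : ∀ i ∈ s, ∀ e, 0 ≤ f i e) :
    flowCost α L (∑ i ∈ s, f i) ≤ ∑ i ∈ s, flowCost α L (f i) := by
  induction s using Finset.induction_on with
  | empty => simp [flowCost]
  | insert i s hi ih =>
    rw [Finset.sum_insert hi, Finset.sum_insert hi]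
    have hs : ∀ j ∈ s, ∀ e, 0 ≤ f j e := fun j hj => hf j (Finset.mem_insert_of_mem hj)
    refine (flowCost_add_le hα0 hα1 hL (hf i (Finset.mem_insert_self i s)) fun e => ?_).trans
      (add_le_add_right (ih hs) _)
    rw [Finsupp.finsetSum_apply]
    exact Finset.sum_nonneg fun j hj => hs j hj e

/-- Tangent line bound for the concave function `t ↦ t ^ α`. -/
lemma rpow_add_le_tangent {α : ℝ} (hα0 : 0 ≤ α) (hα1 : α ≤ 1) {t d : ℝ} (ht : 0 < t)
    (htd : 0 ≤ t + d) : (t + d) ^ α ≤ t ^ α + α * t ^ (α - 1) * d := by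
  have h1 : -1 ≤ d / t := by rw [le_div_iff₀ ht]; linarith
  have h2 : t + d = t * (1 + d / t) := by field_simp
  rw [h2, Real.mul_rpow ht.le (by linarith), Real.rpow_sub_one ht.ne']
  calc t ^ α * (1 + d / t) ^ α ≤ t ^ α * (1 + α * (d / t)) :=
        mul_le_mul_of_nonneg_left (rpow_one_add_le_one_add_mul_self h1 hα0 hα1)
          (Real.rpow_nonneg ht.le _)
    _ = t ^ α + α * (t ^ α / t) * d := by ring

/-- A flow whose support carries a nonzero circulation can be rerouted without increasing the
cost so that its support shrinks. -/
lemma exists_support_ssubset {α : ℝ} (hα0 : 0 ≤ α) (hα1 : α ≤ 1) {L : W × W → ℝ}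
    (hL : ∀ e, 0 ≤ L e) {f h : W × W →₀ ℝ} (hf : ∀ e, 0 ≤ f e) (hh : h ≠ 0)
    (hsupp : h.support ⊆ f.support) (hdiv : divergence h = 0) :
    ∃ g : W × W →₀ ℝ, (∀ e, 0 ≤ g e) ∧ g.support ⊂ f.support ∧
      divergence g = divergence f ∧ flowCost α L g ≤ flowCost α L f := by
  set S : (W × W →₀ ℝ) → ℝ := fun k => ∑ e ∈ f.support, α * (f e) ^ (α - 1) * k e * L e with hS
  obtain ⟨k, hksupp, hkdiv, hkS, e₀, he₀⟩ : ∃ k : W × W →₀ ℝ, k.support ⊆ f.support ∧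
      divergence k = 0 ∧ S k ≤ 0 ∧ ∃ e, k e < 0 := by
    have hSneg : S (-h) = - S h := by simp [hS]
    have hpos : ∀ k : W × W →₀ ℝ, S k < 0 → ∃ e, k e < 0 := by
      intro k hk
      by_contra! hcon
      exact absurd hk (not_lt.2 (Finset.sum_nonneg fun e _ => mul_nonneg
        (mul_nonneg (mul_nonneg hα0 (Real.rpow_nonneg (hf e) _)) (hcon e)) (hL e)))
    have hneg : (-h).support ⊆ f.support := by rwa [Finsupp.support_neg]
    have hdneg : divergence (-h) = 0 := by rw [map_neg, hdiv, neg_zero]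
    rcases lt_trichotomy (S h) 0 with h0 | h0 | h0
    · exact ⟨h, hsupp, hdiv, h0.le, hpos h h0⟩
    · obtain ⟨e, he⟩ := Finsupp.ne_iff.1 hh
      rcases lt_or_gt_of_ne he with he | he
      · exact ⟨h, hsupp, hdiv, h0.le, e, he⟩
      · exact ⟨-h, hneg, hdneg, by rw [hSneg, h0, neg_zero], e, by simpa using he⟩
    · have : S (-h) < 0 := by rw [hSneg]; linarith
      exact ⟨-h, hneg, hdneg, this.le, hpos _ this⟩
  have hfpos : ∀ e, k e ≠ 0 → 0 < f e := fun e he =>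
    lt_of_le_of_ne (hf e) (Ne.symm (Finsupp.mem_support_iff.1
      (hksupp (Finsupp.mem_support_iff.2 he))))
  obtain ⟨e₁, he₁, hmin⟩ := Finset.exists_min_image (k.support.filter fun e => k e < 0)
    (fun e => f e / (- k e)) ⟨e₀, by simp [he₀, he₀.ne]⟩
  simp only [Finset.mem_filter, Finsupp.mem_support_iff] at he₁ hmin
  set t := f e₁ / (- k e₁) with ht
  have ht0 : 0 ≤ t := div_nonneg (hf _) (by linarith [he₁.2])
  have hg0 : ∀ e, 0 ≤ (f + t • k) e := by
    intro e
    simp only [Finsupp.add_apply, Finsupp.smul_apply, smul_eq_mul]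
    rcases lt_or_ge (k e) 0 with hke | hke
    · have := hmin e ⟨hke.ne, hke⟩
      rw [le_div_iff₀ (by linarith)] at this
      linarith
    · have := mul_nonneg ht0 hke
      linarith [hf e]
  have hg1 : (f + t • k) e₁ = 0 := by
    simp only [Finsupp.add_apply, Finsupp.smul_apply, smul_eq_mul, ht]
    have := he₁.1
    field_simp
    ring
  have hsub : (f + t • k).support ⊆ f.support := by
    intro e he
    by_contra hfe
    have h1 : f e = 0 := by simpa using hfe
    have h2 : k e = 0 := by
      by_contra hk
      exact hfe (hksupp (Finsupp.mem_support_iff.2 hk))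
    simp [h1, h2] at he
  refine ⟨f + t • k, hg0, ⟨hsub, fun hcon => ?_⟩, ?_, ?_⟩
  · exact (Finsupp.mem_support_iff.1
      (hcon (Finsupp.mem_support_iff.2 (hfpos e₁ he₁.1).ne'))) hg1
  · rw [map_add, map_smul, hkdiv, smul_zero, add_zero]
  · refine (flowCost_le_sum hL hg0 hsub).trans ?_
    have hterm : ∀ e ∈ f.support, ((f + t • k) e) ^ α * L e ≤
        (f e) ^ α * L e + t * (α * (f e) ^ (α - 1) * k e * L e) := by
      intro e he
      have hfe : 0 < f e := lt_of_le_of_ne (hf e) (Ne.symm (Finsupp.mem_support_iff.1 he))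
      have := mul_le_mul_of_nonneg_right
        (rpow_add_le_tangent hα0 hα1 (d := t * k e) hfe (hg0 e)) (hL e)
      calc _ ≤ _ := this
        _ = _ := by ring
    refine (Finset.sum_le_sum hterm).trans ?_
    rw [Finset.sum_add_distrib, ← Finset.mul_sum]
    have := mul_nonpos_of_nonneg_of_nonpos ht0 hkS
    simp only [flowCost]
    linarith

/-- The edges of the flow `f` support no nonzero circulation. -/
def CirculationFree (f : W × W →₀ ℝ) : Prop :=
  ∀ h : W × W →₀ ℝ, h.support ⊆ f.support → divergence h = 0 → h = 0

lemma exists_circulationFree {α : ℝ} (hα0 : 0 ≤ α) (hα1 : α ≤ 1) {L : W × W → ℝ}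
    (hL : ∀ e, 0 ≤ L e) (f : W × W →₀ ℝ) (hf : ∀ e, 0 ≤ f e) :
    ∃ g : W × W →₀ ℝ, (∀ e, 0 ≤ g e) ∧ g.support ⊆ f.support ∧
      divergence g = divergence f ∧ flowCost α L g ≤ flowCost α L f ∧ CirculationFree g := by
  induction hN : f.support.card using Nat.strong_induction_on generalizing f with
  | _ N ih =>
    by_cases hfree : CirculationFree f
    · exact ⟨f, hf, subset_rfl, rfl, le_rfl, hfree⟩
    · simp only [CirculationFree, not_forall] at hfree
      obtain ⟨h, hsupp, hdiv, hh⟩ := hfree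
      obtain ⟨g, hg, hgs, hgd, hgc⟩ := exists_support_ssubset hα0 hα1 hL hf hh hsupp hdiv
      obtain ⟨g', h1, h2, h3, h4, h5⟩ := ih _ (hN ▸ Finset.card_lt_card hgs) g hg rfl
      exact ⟨g', h1, h2.trans hgs.subset, h3.trans hgd, h4.trans hgc, h5⟩

/-- Along a walk using edges of `f` in either direction there is a unit flow. -/
lemma exists_unit_flow_of_walk (f : W × W →₀ ℝ) {u v : W}
    (p : (SimpleGraph.fromRel fun u v => (u, v) ∈ f.support).Walk u v) :
    ∃ h : W × W →₀ ℝ, h.support ⊆ f.support ∧ (∀ e ∈ h.support, s(e.1, e.2) ∈ p.edges) ∧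
      divergence h = Finsupp.single u 1 - Finsupp.single v 1 := by
  induction p with
  | nil => exact ⟨0, by simp⟩
  | @cons u v w hadj p ih =>
    obtain ⟨h, h1, h2, h3⟩ := ih
    obtain ⟨e, he, hes, c, hc⟩ : ∃ e ∈ f.support, s(e.1, e.2) = s(u, v) ∧ ∃ c : ℝ,
        divergence (Finsupp.single e c) = Finsupp.single u 1 - Finsupp.single v 1 := by
      rcases ((SimpleGraph.fromRel_adj _ _ _).1 hadj).2 with he | he
      · exact ⟨_, he, rfl, 1, divergence_single _ _ _⟩
      · refine ⟨_, he, Sym2.eq_swap, -1, ?_⟩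
        rw [divergence_single, Finsupp.single_neg, Finsupp.single_neg]
        abel
    have hmem : ∀ e' ∈ (Finsupp.single e c + h).support, e' = e ∨ e' ∈ h.support := by
      intro e' he'
      rcases Finset.mem_union.1 (Finsupp.support_add he') with h' | h'
      · exact Or.inl (by simpa using Finsupp.support_single_subset h')
      · exact Or.inr h'
    refine ⟨Finsupp.single e c + h, fun e' he' => ?_, fun e' he' => ?_, ?_⟩
    · rcases hmem e' he' with rfl | h'
      exacts [he, h1 h']
    · rw [SimpleGraph.Walk.edges_cons, List.mem_cons]
      rcases hmem e' he' with rfl | h'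
      exacts [Or.inl hes, Or.inr (h2 _ h')]
    · rw [map_add, hc, h3]; abel

lemma CirculationFree.isAcyclic {f : W × W →₀ ℝ} (hf : CirculationFree f) :
    (SimpleGraph.fromRel fun u v => (u, v) ∈ f.support).IsAcyclic := by
  rw [SimpleGraph.isAcyclic_iff_forall_adj_isBridge]
  intro u v hadj
  rw [SimpleGraph.isBridge_iff_forall_walk_mem_edges]
  intro p
  by_contra hp
  obtain ⟨h, h1, h2, h3⟩ := exists_unit_flow_of_walk f p
  obtain ⟨e, he, hes, c, hc0, hc⟩ : ∃ e ∈ f.support, s(e.1, e.2) = s(u, v) ∧ ∃ c : ℝ, c ≠ 0 ∧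
      divergence (Finsupp.single e c) = Finsupp.single u 1 - Finsupp.single v 1 := by
    rcases ((SimpleGraph.fromRel_adj _ _ _).1 hadj).2 with he | he
    · exact ⟨_, he, rfl, 1, one_ne_zero, divergence_single _ _ _⟩
    · refine ⟨_, he, Sym2.eq_swap, -1, by norm_num, ?_⟩
      rw [divergence_single, Finsupp.single_neg, Finsupp.single_neg]
      abel
  have hzero := hf (h - Finsupp.single e c) (fun e' he' => by
    rcases Finset.mem_union.1 (Finsupp.support_sub he') with h' | h'
    · exact h1 h'
    · have := Finsupp.support_single_subset h'
      rw [Finset.mem_singleton] at this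
      exact this ▸ he) (by rw [map_sub, hc, h3, sub_self])
  have hhe : h e = 0 := by
    by_contra hne
    exact hp (hes ▸ h2 e (Finsupp.mem_support_iff.2 hne))
  have := DFunLike.congr_fun hzero e
  simp [hhe, hc0] at this

lemma CirculationFree.fst_ne_snd {f : W × W →₀ ℝ} (hf : CirculationFree f) {e : W × W}
    (he : e ∈ f.support) : e.1 ≠ e.2 := by
  obtain ⟨u, v⟩ := e
  intro huv
  obtain rfl : u = v := huv
  have := hf (Finsupp.single (u, u) 1) (fun e' he' => by
    have := Finsupp.support_single_subset he'
    rw [Finset.mem_singleton] at this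
    exact this ▸ he) (by rw [divergence_single, sub_self])
  simp at this

/-- Some vertex other than `s` is met by exactly one edge end of a nonzero circulation-free flow. -/
lemma CirculationFree.exists_leaf {f : W × W →₀ ℝ} (hf : CirculationFree f) (hf0 : f ≠ 0)
    (s : W) : ∃ v ≠ s, (f.support.filter fun e => e.1 = v).card +
      (f.support.filter fun e => e.2 = v).card = 1 := by
  by_contra! hcon
  set B : Finset W := f.support.image Prod.fst ∪ f.support.image Prod.snd with hB
  have hfst : ∀ e ∈ f.support, e.1 ∈ B := fun e he =>
    Finset.mem_union_left _ (Finset.mem_image_of_mem _ he)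
  have hsnd : ∀ e ∈ f.support, e.2 ∈ B := fun e he =>
    Finset.mem_union_right _ (Finset.mem_image_of_mem _ he)
  obtain ⟨e₀, he₀⟩ := Finsupp.support_nonempty_iff.2 hf0
  obtain ⟨v₀, hv₀, hsv₀⟩ : ∃ v₀ ∈ B, s ∈ B → v₀ = s := by
    by_cases hs : s ∈ B
    · exact ⟨s, hs, fun _ => rfl⟩
    · exact ⟨e₀.1, hfst e₀ he₀, fun h => absurd h hs⟩
  set deg : W → ℕ := fun v => (f.support.filter fun e => e.1 = v).card +
      (f.support.filter fun e => e.2 = v).card with hdeg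
  have hdegpos : ∀ v ∈ B, 1 ≤ deg v := by
    intro v hv
    rcases Finset.mem_union.1 hv with hv | hv
    · obtain ⟨e, he, rfl⟩ := Finset.mem_image.1 hv
      exact Nat.le_add_right_of_le (Finset.card_pos.2 ⟨e, Finset.mem_filter.2 ⟨he, rfl⟩⟩)
    · obtain ⟨e, he, rfl⟩ := Finset.mem_image.1 hv
      exact Nat.le_add_left_of_le (Finset.card_pos.2 ⟨e, Finset.mem_filter.2 ⟨he, rfl⟩⟩)
  have hdeg2 : ∀ v ∈ B.erase v₀, 2 ≤ deg v := by
    intro v hv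
    obtain ⟨hne, hvB⟩ := Finset.mem_erase.1 hv
    have hvs : v ≠ s := by
      rintro rfl
      exact hne (hsv₀ hvB).symm
    have := hdegpos v hvB
    have := hcon v hvs
    change deg v ≠ 1 at this
    omega
  have hsum : ∑ v ∈ B, deg v = 2 * f.support.card := by
    rw [hdeg, Finset.sum_add_distrib, ← Finset.card_eq_sum_card_fiberwise (f := Prod.fst) hfst,
      ← Finset.card_eq_sum_card_fiberwise (f := Prod.snd) hsnd, two_mul]
  have hlower : 2 * (B.erase v₀).card + 1 ≤ 2 * f.support.card := by
    rw [← hsum, ← Finset.sum_erase_add _ _ hv₀, mul_comm, ← smul_eq_mul]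
    exact add_le_add (Finset.card_nsmul_le_sum _ _ _ hdeg2) (hdegpos v₀ hv₀)
  let Φ : (f.support → ℝ) →ₗ[ℝ] ({v // v ∈ B.erase v₀} → ℝ) :=
    { toFun := fun h v => divergence (Finsupp.mapDomain Subtype.val
        (Finsupp.equivFunOnFinite.symm h)) v
      map_add' := fun h h' => by
        ext v
        rw [show Finsupp.equivFunOnFinite.symm (h + h') = Finsupp.equivFunOnFinite.symm h +
          Finsupp.equivFunOnFinite.symm h' by ext; rfl, Finsupp.mapDomain_add, map_add]
        rfl
      map_smul' := fun c h => by
        ext v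
        rw [show Finsupp.equivFunOnFinite.symm (c • h) = c • Finsupp.equivFunOnFinite.symm h by
          ext; rfl, Finsupp.mapDomain_smul, map_smul]
        rfl }
  have hΦ : Function.Injective Φ := by
    rw [← LinearMap.ker_eq_bot, LinearMap.ker_eq_bot']
    intro h hh
    set k := Finsupp.mapDomain Subtype.val (Finsupp.equivFunOnFinite.symm h) with hk
    have hks : k.support ⊆ f.support := by
      intro e he
      obtain ⟨e', _, rfl⟩ := Finset.mem_image.1 (Finsupp.mapDomain_support he)
      exact e'.2
    have hoff : ∀ v ≠ v₀, divergence k v = 0 := by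
      intro v hv
      by_cases hvB : v ∈ B
      · exact congr_fun hh ⟨v, Finset.mem_erase.2 ⟨hv, hvB⟩⟩
      · refine divergence_apply_eq_zero k fun e he => ⟨?_, ?_⟩
        · rintro rfl; exact hvB (hfst e (hks he))
        · rintro rfl; exact hvB (hsnd e (hks he))
    have hat : divergence k v₀ = 0 := by
      have := sum_divergence k (A := B) fun e he => ⟨hfst e (hks he), hsnd e (hks he)⟩
      rwa [Finset.sum_eq_single_of_mem v₀ hv₀ fun v _ hv => hoff v hv] at this
    have hk0 : k = 0 := hf k hks (by
      ext v
      by_cases hv : v = v₀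
      · rw [hv, hat]; rfl
      · rw [hoff v hv]; rfl)
    ext e
    have := DFunLike.congr_fun hk0 (e : W × W)
    rwa [hk, Finsupp.mapDomain_apply Subtype.val_injective] at this
  have hupper := LinearMap.finrank_le_finrank_of_injective hΦ
  simp only [Module.finrank_fintype_fun_eq_card, Fintype.card_coe] at hupper
  omega

end Flow

section LowerBound

variable {W ι : Type*} [Fintype ι]

/-- Moving the demands sitting at a leaf of a circulation-free flow back along its unique edge,
one bounds the cost of any flow out of `s` from below by any function that is subadditive under
merging demands and controlled along edges. -/
lemma le_sum_add_flowCost {α : ℝ} (hα0 : 0 ≤ α) (hα1 : α ≤ 1) {L : W × W → ℝ}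
    (hL : ∀ e, 0 ≤ L e) {n : ι → ℝ} (hn : ∀ j, 0 < n j) {s : W} {A : Finset W} (hs : s ∈ A)
    {F : Finset ι → W → ℝ} (hF0 : ∀ T, ∀ v ∈ A, 0 ≤ F T v) (hFe : ∀ v ∈ A, F ∅ v ≤ 0)
    (hFu : ∀ v ∈ A, ∀ T₁ T₂, Disjoint T₁ T₂ → F (T₁ ∪ T₂) v ≤ F T₁ v + F T₂ v)
    (f : W × W →₀ ℝ) (hf : ∀ e, 0 ≤ f e) (hfA : ∀ e ∈ f.support, e.1 ∈ A ∧ e.2 ∈ A)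
    (hFm : ∀ e ∈ f.support, ∀ T, F T e.1 ≤ F T e.2 + (∑ j ∈ T, n j) ^ α * L e)
    (σ : ι → W) (hσ : ∀ j, σ j ∈ A)
    (hdiv : divergence f = Finsupp.single s 1 - ∑ j, Finsupp.single (σ j) (n j)) :
    F Finset.univ s ≤
      ∑ v ∈ A, F (Finset.univ.filter fun j => σ j = v) v + flowCost α L f := by
  induction hN : f.support.card using Nat.strong_induction_on generalizing f σ with
  | _ N ih =>
  have hdem : ∀ v, (∑ j, Finsupp.single (σ j) (n j)) v =
      ∑ j ∈ Finset.univ.filter fun j => σ j = v, n j := by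
    intro v
    rw [Finsupp.finsetSum_apply, Finset.sum_filter]
    exact Finset.sum_congr rfl fun j _ => by rw [Finsupp.single_apply]
  by_cases hf0 : f = 0
  · have huniv : (Finset.univ.filter fun j => σ j = s) = Finset.univ := by
      refine Finset.filter_true_of_mem fun j _ => ?_
      by_contra hj
      have h1 := DFunLike.congr_fun hdiv (σ j)
      rw [hf0, map_zero, Finsupp.sub_apply, Finsupp.single_eq_of_ne hj, hdem] at h1
      have h2 : n j ≤ ∑ j' ∈ Finset.univ.filter fun j' => σ j' = σ j, n j' :=
        Finset.single_le_sum (fun i _ => (hn i).le) (by simp)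
      have h3 := hn j
      simp only [Finsupp.coe_zero, Pi.zero_apply] at h1
      linarith
    have h1 := Finset.single_le_sum (f := fun v => F (Finset.univ.filter fun j => σ j = v) v)
      (fun v hv => hF0 _ v hv) hs
    have h2 := flowCost_nonneg (α := α) hL hf
    simp only [huniv] at h1
    linarith
  by_cases hfree : CirculationFree f
  swap
  · simp only [CirculationFree, not_forall] at hfree
    obtain ⟨h, hsupp, hdivh, hh⟩ := hfree
    obtain ⟨g, hg, hgs, hgd, hgc⟩ := exists_support_ssubset hα0 hα1 hL hf hh hsupp hdivh
    have := ih _ (hN ▸ Finset.card_lt_card hgs) g hg (fun e he => hfA e (hgs.subset he))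
      (fun e he => hFm e (hgs.subset he)) σ hσ (hgd.trans hdiv) rfl
    linarith
  obtain ⟨v, hvs, hdeg⟩ := hfree.exists_leaf hf0 s
  have hdv : divergence f v = - ∑ j ∈ Finset.univ.filter fun j => σ j = v, n j := by
    rw [hdiv, Finsupp.sub_apply, Finsupp.single_eq_of_ne hvs, hdem, zero_sub]
  have hnonneg : 0 ≤ ∑ j ∈ Finset.univ.filter fun j => σ j = v, n j :=
    Finset.sum_nonneg fun j _ => (hn j).le
  have hfpos : ∀ e ∈ f.support, 0 < f e := fun e he =>
    lt_of_le_of_ne (hf e) (Ne.symm (Finsupp.mem_support_iff.1 he))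
  obtain ⟨hout, hin⟩ : (f.support.filter fun e => e.1 = v).card = 0 ∧
      (f.support.filter fun e => e.2 = v).card = 1 := by
    by_contra hcon
    have h0 : (f.support.filter fun e => e.2 = v) = ∅ := Finset.card_eq_zero.1 (by omega)
    obtain ⟨e, he⟩ := Finset.card_eq_one.1
      (show (f.support.filter fun e => e.1 = v).card = 1 by omega)
    rw [divergence_apply, h0, he, Finset.sum_singleton, Finset.sum_empty] at hdv
    have : e ∈ f.support := (Finset.mem_filter.1 (he ▸ Finset.mem_singleton_self e)).1
    linarith [hfpos e this]
  rw [Finset.card_eq_zero] at hout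
  obtain ⟨⟨u, v'⟩, he⟩ := Finset.card_eq_one.1 hin
  obtain ⟨hes, hev⟩ := Finset.mem_filter.1 (he ▸ Finset.mem_singleton_self (u, v'))
  obtain rfl : v' = v := hev
  have huv : u ≠ v' := hfree.fst_ne_snd hes
  obtain ⟨huA, hvA⟩ := hfA _ hes
  set D : W → Finset ι := fun w => Finset.univ.filter fun j => σ j = w with hD
  have hflow : f (u, v') = ∑ j ∈ D v', n j := by
    rw [divergence_apply, hout, he, Finset.sum_singleton, Finset.sum_empty] at hdv
    linarith
  set σ' : ι → W := fun j => if σ j = v' then u else σ j with hσ'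
  have hDu : (Finset.univ.filter fun j => σ' j = u) = D u ∪ D v' := by
    ext j
    simp only [hσ', hD, Finset.mem_filter, Finset.mem_univ, true_and, Finset.mem_union]
    split_ifs with h <;> simp [h]
  have hDv : (Finset.univ.filter fun j => σ' j = v') = ∅ := by
    refine Finset.filter_false_of_mem fun j _ => ?_
    simp only [hσ']
    split_ifs with h
    exacts [huv, h]
  have hDw : ∀ w, w ≠ u → w ≠ v' → (Finset.univ.filter fun j => σ' j = w) = D w := by
    intro w hwu hwv
    ext j
    simp only [hσ', hD, Finset.mem_filter, Finset.mem_univ, true_and]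
    split_ifs with h
    · exact ⟨fun h' => absurd h'.symm hwu, fun h' => absurd (h'.symm.trans h) hwv⟩
    · rfl
  have hle : ∀ e, 0 ≤ f.erase (u, v') e := by
    intro e
    rw [Finsupp.erase_apply]
    split_ifs
    exacts [le_rfl, hf e]
  have hsub : (f.erase (u, v')).support ⊆ f.support := by
    rw [Finsupp.support_erase]; exact Finset.erase_subset _ _
  have hsplit := Finsupp.single_add_erase (u, v') f
  have hdiv' : divergence (f.erase (u, v')) =
      Finsupp.single s 1 - ∑ j, Finsupp.single (σ' j) (n j) := by
    have h1 := congr_arg divergence hsplit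
    rw [map_add, divergence_single, hdiv] at h1
    have h2 : ∑ j, Finsupp.single (σ' j) (n j) = ∑ j, Finsupp.single (σ j) (n j) +
        (Finsupp.single u (f (u, v')) - Finsupp.single v' (f (u, v'))) := by
      rw [hflow, Finsupp.single_finsetSum, Finsupp.single_finsetSum, ← Finset.sum_sub_distrib,
        Finset.sum_filter, ← Finset.sum_add_distrib]
      refine Finset.sum_congr rfl fun j _ => ?_
      simp only [hσ']
      split_ifs with h
      · rw [h]; abel
      · rw [add_zero]
    rw [h2, eq_sub_of_add_eq' h1]
    abel
  have key := ih _ (by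
    rw [← hN, Finsupp.support_erase]
    exact Finset.card_erase_lt_of_mem hes) (f.erase (u, v')) hle (fun e he => hfA e (hsub he))
      (fun e he => hFm e (hsub he)) σ' (fun j => by
        simp only [hσ']
        split_ifs
        exacts [huA, hσ j]) hdiv' rfl
  have hcost : flowCost α L f = f (u, v') ^ α * L (u, v') + flowCost α L (f.erase (u, v')) := by
    rw [flowCost, flowCost, Finsupp.support_erase, ← Finset.add_sum_erase _ _ hes]
    congr 1
    exact Finset.sum_congr rfl fun e he => by rw [Finsupp.erase_ne (Finset.ne_of_mem_erase he)]
  have huA' : u ∈ A.erase v' := Finset.mem_erase.2 ⟨huv, huA⟩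
  rw [← Finset.add_sum_erase _ _ hvA, ← Finset.add_sum_erase _ _ huA', hDu, hDv,
    Finset.sum_congr rfl fun w hw => by
      rw [hDw w (Finset.ne_of_mem_erase hw)
        (Finset.ne_of_mem_erase (Finset.mem_of_mem_erase hw))]] at key
  rw [← Finset.add_sum_erase _ _ hvA, ← Finset.add_sum_erase _ _ huA', hcost, hflow]
  have hdisj : Disjoint (D u) (D v') := by
    rw [Finset.disjoint_left]
    intro j h1 h2
    simp only [hD, Finset.mem_filter] at h1 h2
    exact huv (h1.2.symm.trans h2.2)
  have := hFu u huA _ _ hdisj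
  have := hFm _ hes (D v')
  have := hFe v' hvA
  linarith

end LowerBound

section Delivery

variable {m k ℓ : ℕ} {X : Set (Pt m)} {α : ℝ} {x : Fin k → Pt m} {y : Fin ℓ → Pt m}
  {n : Fin ℓ → ℝ}

/-- `Delivery X α x y n T v c`: the households in `T` can be served by a branching tree of cost
`c` rooted at the point `v`, or, for `v = none`, by trees rooted at factories. -/
inductive Delivery (X : Set (Pt m)) (α : ℝ) (x : Fin k → Pt m) (y : Fin ℓ → Pt m)
    (n : Fin ℓ → ℝ) : Finset (Fin ℓ) → Option (Pt m) → ℝ → Prop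
  | empty (v : Option (Pt m)) : Delivery X α x y n ∅ v 0
  | leaf (j : Fin ℓ) : Delivery X α x y n {j} (some (y j)) 0
  | move (p q : Pt m) (T : Finset (Fin ℓ)) (c : ℝ) (hq : q ∈ X)
      (h : Delivery X α x y n T (some q) c) :
      Delivery X α x y n T (some p) (c + (∑ j ∈ T, n j) ^ α * dist p q)
  | merge (T₁ T₂ : Finset (Fin ℓ)) (v : Option (Pt m)) (c₁ c₂ : ℝ) (hd : Disjoint T₁ T₂)
      (h₁ : Delivery X α x y n T₁ v c₁) (h₂ : Delivery X α x y n T₂ v c₂) :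
      Delivery X α x y n (T₁ ∪ T₂) v (c₁ + c₂)
  | root (i : Fin k) (T : Finset (Fin ℓ)) (c : ℝ) (h : Delivery X α x y n T (some (x i)) c) :
      Delivery X α x y n T none c

namespace Delivery

lemma nonneg (hn : ∀ j, 0 ≤ n j) {T : Finset (Fin ℓ)} {v : Option (Pt m)} {c : ℝ}
    (h : Delivery X α x y n T v c) : 0 ≤ c := by
  induction h with
  | empty => exact le_rfl
  | leaf => exact le_rfl
  | move p q T c hq h ih =>
    exact add_nonneg ih (mul_nonneg (Real.rpow_nonneg (Finset.sum_nonneg fun j _ => hn j) _)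
      dist_nonneg)
  | merge T₁ T₂ v c₁ c₂ hd h₁ h₂ ih₁ ih₂ => exact add_nonneg ih₁ ih₂
  | root i T c h ih => exact ih

lemma exists_cost (hk : 0 < k) (hy : ∀ j, y j ∈ X) (T : Finset (Fin ℓ)) (v : Option (Pt m)) :
    ∃ c, Delivery X α x y n T v c := by
  have hsome : ∀ p, ∃ c, Delivery X α x y n T (some p) c := by
    intro p
    induction T using Finset.induction_on with
    | empty => exact ⟨0, empty _⟩
    | insert j T hj ih =>
      obtain ⟨c, hc⟩ := ih
      exact ⟨_, Finset.insert_eq j T ▸ merge {j} T _ _ _ (Finset.disjoint_singleton_left.2 hj)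
        (move p (y j) {j} 0 (hy j) (leaf j)) hc⟩
  cases v with
  | some p => exact hsome p
  | none =>
    obtain ⟨c, hc⟩ := hsome (x ⟨0, hk⟩)
    exact ⟨c, root _ T c hc⟩

/-- Up to lowering the cost, a delivery tree at a point starts with a single edge leading either
to the only household served or to a proper branching. -/
lemma normal_form_some (hn : ∀ j, 0 ≤ n j) {T : Finset (Fin ℓ)}
    {v : Option (Pt m)} {c : ℝ} (h : Delivery X α x y n T v c) (hT : T.Nonempty) (p : Pt m)
    (hp : p ∈ X) (hv : v = some p) :
    (∃ j, T = {j} ∧ (∑ j ∈ T, n j) ^ α * dist p (y j) ≤ c) ∨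
      ∃ T₁ ⊂ T, T₁.Nonempty ∧ ∃ q ∈ X, ∃ c₁ c₂, Delivery X α x y n T₁ (some q) c₁ ∧
        Delivery X α x y n (T \ T₁) (some q) c₂ ∧
        c₁ + c₂ + (∑ j ∈ T, n j) ^ α * dist p q ≤ c := by
  induction h generalizing p with
  | empty => exact absurd hT Finset.not_nonempty_empty
  | leaf j =>
    obtain rfl : y j = p := Option.some.inj hv
    exact Or.inl ⟨j, rfl, by simp⟩
  | move p' q T c hq h ih =>
    obtain rfl : p' = p := Option.some.inj hv
    have hM : 0 ≤ (∑ j ∈ T, n j) ^ α := Real.rpow_nonneg (Finset.sum_nonneg fun j _ => hn j) _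
    have htri : ∀ r, (∑ j ∈ T, n j) ^ α * dist p' r ≤
        (∑ j ∈ T, n j) ^ α * dist p' q + (∑ j ∈ T, n j) ^ α * dist q r := fun r => by
      rw [← mul_add]; exact mul_le_mul_of_nonneg_left (dist_triangle _ _ _) hM
    rcases ih hT q hq rfl with ⟨j, hj, hc⟩ | ⟨T₁, hs, hne, r, hr, c₁, c₂, h₁, h₂, hc⟩
    · exact Or.inl ⟨j, hj, by linarith [htri (y j)]⟩
    · exact Or.inr ⟨T₁, hs, hne, r, hr, c₁, c₂, h₁, h₂, by linarith [htri r]⟩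
  | merge T₁ T₂ v c₁ c₂ hd h₁ h₂ ih₁ ih₂ =>
    subst hv
    rcases T₁.eq_empty_or_nonempty with rfl | hT₁
    · rw [Finset.empty_union] at hT ⊢
      have := h₁.nonneg hn
      rcases ih₂ hT p hp rfl with ⟨j, hj, hc⟩ | ⟨T₁, hs, hne, r, hr, c₁, c₂, h₁, h₂, hc⟩
      · exact Or.inl ⟨j, hj, by linarith⟩
      · exact Or.inr ⟨T₁, hs, hne, r, hr, c₁, c₂, h₁, h₂, by linarith⟩
    rcases T₂.eq_empty_or_nonempty with rfl | hT₂
    · rw [Finset.union_empty] at hT ⊢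
      have := h₂.nonneg hn
      rcases ih₁ hT p hp rfl with ⟨j, hj, hc⟩ | ⟨T₁, hs, hne, r, hr, c₁, c₂, h₁, h₂, hc⟩
      · exact Or.inl ⟨j, hj, by linarith⟩
      · exact Or.inr ⟨T₁, hs, hne, r, hr, c₁, c₂, h₁, h₂, by linarith⟩
    refine Or.inr ⟨T₁, ?_, hT₁, p, hp, c₁, c₂, h₁, ?_, by simp⟩
    · exact left_lt_sup.2 fun hle => hT₂.ne_empty (hd.symm.eq_bot_of_le hle)
    · rwa [Finset.union_sdiff_cancel_left hd]
  | root => cases hv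

lemma normal_form_none (hn : ∀ j, 0 ≤ n j) {T : Finset (Fin ℓ)} {v : Option (Pt m)} {c : ℝ}
    (h : Delivery X α x y n T v c) (hT : T.Nonempty) (hv : v = none) :
    (∃ i c', Delivery X α x y n T (some (x i)) c' ∧ c' ≤ c) ∨
      ∃ T₁ ⊂ T, T₁.Nonempty ∧ ∃ c₁ c₂, Delivery X α x y n T₁ none c₁ ∧
        Delivery X α x y n (T \ T₁) none c₂ ∧ c₁ + c₂ ≤ c := by
  induction h with
  | empty => exact absurd hT Finset.not_nonempty_empty
  | leaf j => cases hv
  | move p' q T c hq h ih => cases hv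
  | merge T₁ T₂ v c₁ c₂ hd h₁ h₂ ih₁ ih₂ =>
    subst hv
    rcases T₁.eq_empty_or_nonempty with rfl | hT₁
    · rw [Finset.empty_union] at hT ⊢
      have := h₁.nonneg hn
      rcases ih₂ hT rfl with ⟨i, c', h', hc⟩ | ⟨T₁, hs, hne, c₁, c₂, h₁, h₂, hc⟩
      · exact Or.inl ⟨i, c', h', by linarith⟩
      · exact Or.inr ⟨T₁, hs, hne, c₁, c₂, h₁, h₂, by linarith⟩
    rcases T₂.eq_empty_or_nonempty with rfl | hT₂
    · rw [Finset.union_empty] at hT ⊢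
      have := h₂.nonneg hn
      rcases ih₁ hT rfl with ⟨i, c', h', hc⟩ | ⟨T₁, hs, hne, c₁, c₂, h₁, h₂, hc⟩
      · exact Or.inl ⟨i, c', h', by linarith⟩
      · exact Or.inr ⟨T₁, hs, hne, c₁, c₂, h₁, h₂, by linarith⟩
    refine Or.inr ⟨T₁, ?_, hT₁, c₁, c₂, h₁, ?_, le_rfl⟩
    · exact left_lt_sup.2 fun hle => hT₂.ne_empty (hd.symm.eq_bot_of_le hle)
    · rwa [Finset.union_sdiff_cancel_left hd]
  | root i T c h ih => exact Or.inl ⟨i, c, h, le_rfl⟩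

end Delivery

lemma exists_isLeast_of_finset {S : Set ℝ} (hS : S.Nonempty) (C : Finset ℝ) (hC : ↑C ⊆ S)
    (h : ∀ c ∈ S, ∃ c' ∈ C, c' ≤ c) : ∃ c, IsLeast S c := by
  obtain ⟨c, hc⟩ := hS
  obtain ⟨c', hc', _⟩ := h c hc
  refine ⟨C.min' ⟨c', hc'⟩, hC (C.min'_mem _), fun d hd => ?_⟩
  obtain ⟨d', hd', hle⟩ := h d hd
  exact (C.min'_le d' hd').trans hle

/-- The least cost of serving `T` from `v`. -/
def minDelivery (X : Set (Pt m)) (α : ℝ) (x : Fin k → Pt m) (y : Fin ℓ → Pt m)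
    (n : Fin ℓ → ℝ) (T : Finset (Fin ℓ)) (v : Option (Pt m)) : ℝ :=
  sInf {c | Delivery X α x y n T v c}

lemma Delivery.exists_isLeast (hXc : IsCompact X) (hn : ∀ j, 0 ≤ n j) (hk : 0 < k)
    (hx : ∀ i, x i ∈ X) (hy : ∀ j, y j ∈ X) (T : Finset (Fin ℓ)) (v : Option (Pt m))
    (hv : ∀ p, v = some p → p ∈ X) : ∃ c, IsLeast {c | Delivery X α x y n T v c} c := by
  induction T using Finset.strongInduction generalizing v with
  | H T ih =>
  rcases T.eq_empty_or_nonempty with rfl | hT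
  · exact ⟨0, Delivery.empty v, fun c hc => hc.nonneg hn⟩
  have hM : 0 ≤ (∑ j ∈ T, n j) ^ α := Real.rpow_nonneg (Finset.sum_nonneg fun j _ => hn j) _
  set F := minDelivery X α x y n with hF
  have hFleast : ∀ T' ⊂ T, ∀ v : Option (Pt m), (∀ p, v = some p → p ∈ X) →
      IsLeast {c | Delivery X α x y n T' v c} (F T' v) := by
    intro T' hT' v hv
    obtain ⟨c, hc⟩ := ih T' hT' v hv
    rw [hF, minDelivery, hc.csInf_eq]
    exact hc
  set 𝒮 := T.ssubsets.filter Finset.Nonempty with h𝒮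
  have h𝒮mem : ∀ T₁ ∈ 𝒮, T₁ ⊂ T ∧ T \ T₁ ⊂ T := by
    intro T₁ h₁
    simp only [h𝒮, Finset.mem_filter, Finset.mem_ssubsets] at h₁
    exact ⟨h₁.1, Finset.sdiff_ssubset h₁.1.subset h₁.2⟩
  have hsome : ∀ p ∈ X, ∃ c, IsLeast {c | Delivery X α x y n T (some p) c} c := by
    intro p hp
    have hFcont : ∀ T' ⊂ T, ContinuousOn (fun q => F T' (some q)) X := by
      intro T' hT'
      refine (LipschitzOnWith.of_le_add_mul ⟨(∑ j ∈ T', n j) ^ α,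
        Real.rpow_nonneg (Finset.sum_nonneg fun j _ => hn j) _⟩ fun q hq r hr => ?_).continuousOn
      exact (hFleast T' hT' (some q) fun _ h => Option.some.inj h ▸ hq).2
        (Delivery.move q r T' _ hr (hFleast T' hT' (some r) fun _ h => Option.some.inj h ▸ hr).1)
    set φ : Finset (Fin ℓ) → Pt m → ℝ := fun T₁ q =>
      F T₁ (some q) + F (T \ T₁) (some q) + (∑ j ∈ T, n j) ^ α * dist p q with hφ
    have hmin : ∀ T₁ : Finset (Fin ℓ), ∃ q, T₁ ∈ 𝒮 → q ∈ X ∧ ∀ r ∈ X, φ T₁ q ≤ φ T₁ r := by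
      intro T₁
      by_cases h₁ : T₁ ∈ 𝒮
      · have hcont : ContinuousOn (φ T₁) X :=
          ((hFcont _ (h𝒮mem T₁ h₁).1).add (hFcont _ (h𝒮mem T₁ h₁).2)).add
            (by fun_prop)
        obtain ⟨q, hq, hqmin⟩ := hXc.exists_isMinOn ⟨p, hp⟩ hcont
        exact ⟨q, fun _ => ⟨hq, fun r hr => hqmin hr⟩⟩
      · exact ⟨p, fun h => absurd h h₁⟩
    choose q hq using hmin
    refine exists_isLeast_of_finset (Delivery.exists_cost hk hy T _)
      (𝒮.image (fun T₁ => φ T₁ (q T₁)) ∪ (Finset.univ.filter fun j => T = {j}).image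
        fun j => (∑ j ∈ T, n j) ^ α * dist p (y j)) ?_ ?_
    · intro c hc
      rcases Finset.mem_union.1 hc with hc | hc
      · obtain ⟨T₁, h₁, rfl⟩ := Finset.mem_image.1 hc
        obtain ⟨hs₁, hs₂⟩ := h𝒮mem T₁ h₁
        have hqX : ∀ r, some (q T₁) = some r → r ∈ X := fun _ h =>
          Option.some.inj h ▸ (hq T₁ h₁).1
        have := Delivery.merge _ _ _ _ _ Finset.disjoint_sdiff (hFleast _ hs₁ _ hqX).1
          (hFleast _ hs₂ _ hqX).1
        rw [Finset.union_sdiff_of_subset hs₁.subset] at this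
        exact Delivery.move p _ _ _ (hq T₁ h₁).1 this
      · obtain ⟨j, hj, rfl⟩ := Finset.mem_image.1 hc
        obtain rfl := (Finset.mem_filter.1 hj).2
        simpa using Delivery.move p (y j) {j} 0 (hy j) (Delivery.leaf (X := X) (x := x) j)
    · intro c hc
      rcases hc.normal_form_some hn hT p hp rfl with
        ⟨j, hj, hle⟩ | ⟨T₁, hs, hne, r, hr, c₁, c₂, h₁, h₂, hle⟩
      · exact ⟨_, Finset.mem_union_right _ (Finset.mem_image_of_mem _
          (Finset.mem_filter.2 ⟨Finset.mem_univ j, hj⟩)), hle⟩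
      · have hmem : T₁ ∈ 𝒮 := Finset.mem_filter.2 ⟨Finset.mem_ssubsets.2 hs, hne⟩
        have hrX : ∀ s, some r = some s → s ∈ X := fun _ h => Option.some.inj h ▸ hr
        refine ⟨_, Finset.mem_union_left _ (Finset.mem_image_of_mem _ hmem), ?_⟩
        have e₁ := (hFleast _ hs _ hrX).2 h₁
        have e₂ := (hFleast _ (h𝒮mem T₁ hmem).2 _ hrX).2 h₂
        have e₃ := (hq T₁ hmem).2 r hr
        simp only [hφ] at e₃ ⊢
        linarith
  cases v with
  | some p => exact hsome p (hv p rfl)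
  | none =>
    choose d hd using fun i => hsome (x i) (hx i)
    have hX : ∀ p : Pt m, none = some p → p ∈ X := fun _ h => by cases h
    refine exists_isLeast_of_finset (Delivery.exists_cost hk hy T _)
      (𝒮.image (fun T₁ => F T₁ none + F (T \ T₁) none) ∪ Finset.univ.image d) ?_ ?_
    · intro c hc
      rcases Finset.mem_union.1 hc with hc | hc
      · obtain ⟨T₁, h₁, rfl⟩ := Finset.mem_image.1 hc
        obtain ⟨hs₁, hs₂⟩ := h𝒮mem T₁ h₁
        have := Delivery.merge _ _ _ _ _ Finset.disjoint_sdiff (hFleast _ hs₁ _ hX).1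
          (hFleast _ hs₂ _ hX).1
        rwa [Finset.union_sdiff_of_subset hs₁.subset] at this
      · obtain ⟨i, -, rfl⟩ := Finset.mem_image.1 hc
        exact Delivery.root i T _ (hd i).1
    · intro c hc
      rcases hc.normal_form_none hn hT rfl with
        ⟨i, c', h', hle⟩ | ⟨T₁, hs, hne, c₁, c₂, h₁, h₂, hle⟩
      · exact ⟨d i, Finset.mem_union_right _ (Finset.mem_image_of_mem _ (Finset.mem_univ i)),
          ((hd i).2 h').trans hle⟩
      · have hmem : T₁ ∈ 𝒮 := Finset.mem_filter.2 ⟨Finset.mem_ssubsets.2 hs, hne⟩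
        refine ⟨_, Finset.mem_union_left _ (Finset.mem_image_of_mem _ hmem), ?_⟩
        have e₁ := (hFleast _ hs _ hX).2 h₁
        have e₂ := (hFleast _ (h𝒮mem T₁ hmem).2 _ hX).2 h₂
        linarith

/-- A delivery scheme is realized by a flow of no larger cost. -/
lemma Delivery.exists_flow (hα0 : 0 ≤ α) (hα1 : α ≤ 1) (hn : ∀ j, 0 ≤ n j)
    (hx : ∀ i, x i ∈ X) {T : Finset (Fin ℓ)} {v : Option (Pt m)} {c : ℝ}
    (h : Delivery X α x y n T v c) (hv : ∀ p, v = some p → p ∈ X) :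
    ∃ (f : Pt m × Pt m →₀ ℝ) (a : Pt m →₀ ℝ), (∀ e, 0 ≤ f e) ∧
      (∀ e ∈ f.support, e.1 ∈ X ∧ e.2 ∈ X) ∧ (∀ z, 0 ≤ a z) ∧
      (∀ p, v = some p → a = Finsupp.single p (∑ j ∈ T, n j)) ∧
      (v = none → ↑a.support ⊆ Set.range x) ∧ massOf a = ∑ j ∈ T, n j ∧
      divergence f = a - ∑ j ∈ T, Finsupp.single (y j) (n j) ∧
      flowCost α (fun e => dist e.1 e.2) f ≤ c := by
  have hL : ∀ e : Pt m × Pt m, 0 ≤ dist e.1 e.2 := fun _ => dist_nonneg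
  have hS : ∀ T : Finset (Fin ℓ), 0 ≤ ∑ j ∈ T, n j := fun T => Finset.sum_nonneg fun j _ => hn j
  have hsingle : ∀ {β : Type} (b : β) {t : ℝ}, 0 ≤ t → ∀ z, 0 ≤ Finsupp.single b t z := by
    intro β b t ht z
    rw [Finsupp.single_apply]
    split_ifs
    exacts [ht, le_rfl]
  have hmass : ∀ (p : Pt m) (t : ℝ), massOf (Finsupp.single p t) = t := fun p t => by
    simp [massOf]
  induction h with
  | empty v => exact ⟨0, 0, by simp [massOf, flowCost]⟩
  | leaf j =>
    refine ⟨0, Finsupp.single (y j) (n j), by simp, by simp, hsingle _ (hn j), fun p hp => ?_,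
      by simp, by simp [hmass], by simp, by simp [flowCost]⟩
    rw [Option.some.inj hp, Finset.sum_singleton]
  | move p q T c hq h ih =>
    obtain ⟨f, a, hf, hfX, ha, hap, -, -, hdiv, hcost⟩ := ih fun _ h => Option.some.inj h ▸ hq
    obtain rfl := hap q rfl
    have hp := hv p rfl
    refine ⟨f + Finsupp.single (p, q) (∑ j ∈ T, n j), Finsupp.single p (∑ j ∈ T, n j),
      fun e => add_nonneg (hf e) (hsingle _ (hS T) e), fun e he => ?_, hsingle _ (hS T),
      fun p' hp' => by rw [Option.some.inj hp'], by simp, hmass _ _, ?_, ?_⟩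
    · rcases Finset.mem_union.1 (Finsupp.support_add he) with h' | h'
      · exact hfX e h'
      · obtain rfl : e = (p, q) := by simpa using Finsupp.support_single_subset h'
        exact ⟨hp, hq⟩
    · rw [map_add, divergence_single, hdiv]; abel
    · exact (flowCost_add_le hα0 hα1 hL hf (hsingle _ (hS T))).trans
        (add_le_add hcost (flowCost_single_le hL _ (hS T)))
  | merge T₁ T₂ v c₁ c₂ hd h₁ h₂ ih₁ ih₂ =>
    obtain ⟨f, a, hf, hfX, ha, hap, han, hma, hdiv, hcost⟩ := ih₁ hv
    obtain ⟨f', a', hf', hfX', ha', hap', han', hma', hdiv', hcost'⟩ := ih₂ hv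
    refine ⟨f + f', a + a', fun e => add_nonneg (hf e) (hf' e), fun e he => ?_,
      fun z => add_nonneg (ha z) (ha' z), fun p hp => ?_, fun hv z hz => ?_, ?_, ?_,
      (flowCost_add_le hα0 hα1 hL hf hf').trans (add_le_add hcost hcost')⟩
    · rcases Finset.mem_union.1 (Finsupp.support_add he) with h' | h'
      exacts [hfX e h', hfX' e h']
    · rw [hap p hp, hap' p hp, ← Finsupp.single_add, Finset.sum_union hd]
    · rcases Finset.mem_union.1 (Finsupp.support_add hz) with h' | h'
      exacts [han hv h', han' hv h']
    · rw [Finset.sum_union hd, ← hma, ← hma']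
      exact Finsupp.sum_add_index' (fun _ => rfl) fun _ _ _ => rfl
    · rw [map_add, hdiv, hdiv', Finset.sum_union hd]; abel
  | root i T c h ih =>
    obtain ⟨f, a, hf, hfX, ha, hap, -, hma, hdiv, hcost⟩ :=
      ih fun _ h => Option.some.inj h ▸ hx i
    refine ⟨f, a, hf, hfX, ha, by simp, fun _ z hz => ?_, hma, hdiv, hcost⟩
    rw [hap _ rfl] at hz
    exact ⟨i, (Finset.mem_singleton.1 (Finsupp.support_single_subset hz)).symm⟩

end Delivery

section Allocation

variable {m k ℓ : ℕ} {X : Set (Pt m)} {α : ℝ}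

lemma cost_nonneg {G : WDG m} (hG : G.edgesOK) : 0 ≤ G.cost α :=
  Finset.sum_nonneg fun e he => mul_nonneg (Real.rpow_nonneg (hG e he).2.2.2.le _) dist_nonneg

/-- Every flow in `X` from `a` to `b` can be replaced by a transport path of no larger cost. -/
lemma exists_transportPath_of_flow (hα0 : 0 ≤ α) (hα1 : α ≤ 1) {f : Pt m × Pt m →₀ ℝ}
    (hf : ∀ e, 0 ≤ f e) (hfX : ∀ e ∈ f.support, e.1 ∈ X ∧ e.2 ∈ X) {a b : Pt m →₀ ℝ}
    (ha : ↑a.support ⊆ X) (hb : ↑b.support ⊆ X) (hdiv : divergence f = a - b) :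
    ∃ G : WDG m, IsTransportPath X G a b ∧ G.cost α ≤ flowCost α (fun e => dist e.1 e.2) f := by
  obtain ⟨g, hg, hgs, hgd, hgc, hfree⟩ := exists_circulationFree hα0 hα1
    (L := fun e : Pt m × Pt m => dist e.1 e.2) (fun _ => dist_nonneg) f hf
  refine ⟨⟨g.support.image Prod.fst ∪ g.support.image Prod.snd ∪ (a.support ∪ b.support),
    g.support, g⟩, ⟨fun e he => ⟨?_, ?_, hfree.fst_ne_snd he, ?_⟩, ?_, ?_, ?_,
      hfree.isAcyclic, fun v => ?_⟩, hgc⟩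
  · exact Finset.mem_union_left _ (Finset.mem_union_left _ (Finset.mem_image_of_mem _ he))
  · exact Finset.mem_union_left _ (Finset.mem_union_right _ (Finset.mem_image_of_mem _ he))
  · exact lt_of_le_of_ne (hg e) (Ne.symm (Finsupp.mem_support_iff.1 he))
  · intro z hz
    simp only [Finset.coe_union, Finset.coe_image, Set.mem_union, Set.mem_image] at hz
    rcases hz with (⟨e, he, rfl⟩ | ⟨e, he, rfl⟩) | hz | hz
    exacts [(hfX e (hgs he)).1, (hfX e (hgs he)).2, ha hz, hb hz]
  · exact fun z hz => Finset.mem_union_right _ (Finset.mem_union_left _ hz)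
  · exact fun z hz => Finset.mem_union_right _ (Finset.mem_union_right _ hz)
  · rw [← Finsupp.sub_apply, ← hdiv, ← hgd, divergence_apply]
    simp only [WDG.outflow, WDG.inflow]
    congr!

lemma massOf_sum_single {ι : Type*} (s : Finset ι) (p : ι → Pt m) (t : ι → ℝ) :
    massOf (∑ i ∈ s, Finsupp.single (p i) (t i)) = ∑ i ∈ s, t i := by
  rw [massOf, ← Finsupp.sum_finsetSum_index (fun _ => rfl) fun _ _ _ => rfl]
  exact Finset.sum_congr rfl fun i _ => Finsupp.sum_single_index rfl

lemma support_sum_single_subset {ι β : Type*} [Fintype ι] (p : ι → β) (t : ι → ℝ) :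
    ↑(∑ i, Finsupp.single (p i) (t i)).support ⊆ Set.range p := by
  intro z hz
  obtain ⟨i, -, hi⟩ := Finset.mem_biUnion.1 (Finsupp.support_finsetSum hz)
  exact ⟨i, (Finset.mem_singleton.1 (Finsupp.support_single_subset hi)).symm⟩

lemma sum_single_nonneg {ι β : Type*} (s : Finset ι) (p : ι → β) {t : ι → ℝ}
    (ht : ∀ i ∈ s, 0 ≤ t i) (z : β) : 0 ≤ (∑ i ∈ s, Finsupp.single (p i) (t i)) z := by
  rw [Finsupp.finsetSum_apply]
  refine Finset.sum_nonneg fun i hi => ?_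
  rw [Finsupp.single_apply]
  split_ifs
  exacts [ht i hi, le_rfl]

lemma eq_sum_single_of_support_subset {ι β : Type*} [Fintype ι] {p : ι → β}
    (hp : Function.Injective p) {a : β →₀ ℝ} (ha : ↑a.support ⊆ Set.range p) :
    a = ∑ i, Finsupp.single (p i) (a (p i)) := by
  ext z
  rw [Finsupp.finsetSum_apply]
  by_cases hz : z ∈ Set.range p
  · obtain ⟨i, rfl⟩ := hz
    rw [Finset.sum_eq_single_of_mem i (Finset.mem_univ i) fun j _ hj =>
      Finsupp.single_eq_of_ne fun h => hj (hp h).symm, Finsupp.single_eq_same]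
  · rw [Finsupp.notMem_support_iff.1 fun h => hz (ha h)]
    exact (Finset.sum_eq_zero fun i _ => Finsupp.single_eq_of_ne fun h => hz ⟨i, h.symm⟩).symm

lemma exists_transportPath (hα0 : 0 ≤ α) (hα1 : α ≤ 1) {x : Fin k → Pt m} {y : Fin ℓ → Pt m}
    (hx : ∀ i, x i ∈ X) (hy : ∀ j, y j ∈ X) {mv : Fin k → ℝ} {n : Fin ℓ → ℝ}
    (hmv : ∀ i, 0 ≤ mv i) (hn : ∀ j, 0 ≤ n j) (hsum : ∑ i, mv i = ∑ j, n j) (hk : 0 < k) :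
    ∃ G : WDG m, IsTransportPath X G (∑ i, Finsupp.single (x i) (mv i)) (bMeas y n) := by
  set o := x ⟨0, hk⟩
  have hrange : ∀ e ∈ (∑ i, Finsupp.single (x i, o) (mv i) +
      ∑ j, Finsupp.single (o, y j) (n j)).support, e.1 ∈ X ∧ e.2 ∈ X := by
    intro e he
    rcases Finset.mem_union.1 (Finsupp.support_add he) with h | h
    · obtain ⟨i, rfl⟩ := support_sum_single_subset _ _ h
      exact ⟨hx i, hx _⟩
    · obtain ⟨j, rfl⟩ := support_sum_single_subset _ _ h
      exact ⟨hx _, hy j⟩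
  obtain ⟨G, hG, -⟩ := exists_transportPath_of_flow hα0 hα1
    (f := ∑ i, Finsupp.single (x i, o) (mv i) + ∑ j, Finsupp.single (o, y j) (n j))
    (a := ∑ i, Finsupp.single (x i) (mv i)) (b := bMeas y n)
    (fun e => add_nonneg (sum_single_nonneg _ _ (fun i _ => hmv i) e)
      (sum_single_nonneg _ _ (fun j _ => hn j) e)) hrange
    ((support_sum_single_subset _ _).trans (Set.range_subset_iff.2 hx))
    ((support_sum_single_subset _ _).trans (Set.range_subset_iff.2 hy)) (by
      simp only [map_add, map_sum, divergence_single, Finset.sum_sub_distrib,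
        ← Finsupp.single_finsetSum, hsum, bMeas]
      abel)
  exact ⟨G, hG⟩

/-- Lengths of the edges in the graph obtained by joining a super-source `none` to the
factories by edges of length zero. -/
def extendedDist : Option (Pt m) × Option (Pt m) → ℝ
  | (some p, some q) => dist p q
  | _ => 0

lemma extendedDist_nonneg (e : Option (Pt m) × Option (Pt m)) : 0 ≤ extendedDist e := by
  rcases e with ⟨_ | p, _ | q⟩
  exacts [le_rfl, le_rfl, le_rfl, dist_nonneg]

/-- The least cost of a delivery scheme bounds the cost of every allocation path from below. -/
lemma minDelivery_le_cost (hXc : IsCompact X) (hα0 : 0 ≤ α) (hα1 : α ≤ 1)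
    {x : Fin k → Pt m} (hx : ∀ i, x i ∈ X) {y : Fin ℓ → Pt m} (hyinj : Function.Injective y)
    (hy : ∀ j, y j ∈ X) {n : Fin ℓ → ℝ} (hn : ∀ j, 0 < n j) (hk : 0 < k) {G : WDG m}
    (hG : IsAllocPath X x y n G) : minDelivery X α x y n Finset.univ none ≤ G.cost α := by
  obtain ⟨a, ha, hax, hmass, hE, hV, haV, hbV, -, hbal⟩ := hG
  have hleast : ∀ T, ∀ v : Option (Pt m), (∀ p, v = some p → p ∈ X) →
      IsLeast {c | Delivery X α x y n T v c} (minDelivery X α x y n T v) := by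
    intro T v hv
    obtain ⟨c, hc⟩ := Delivery.exists_isLeast hXc (fun j => (hn j).le) hk hx hy T v hv
    rw [minDelivery, hc.csInf_eq]
    exact hc
  have hw : ∀ e ∈ G.E, 0 ≤ G.w e := fun e he => (hE e he).2.2.2.le
  set A : Finset (Option (Pt m)) := insert none (G.V.image some) with hA
  have hsomeA : ∀ {p}, p ∈ G.V → some p ∈ A := fun hp =>
    Finset.mem_insert_of_mem (Finset.mem_image_of_mem _ hp)
  have hAX : ∀ v ∈ A, ∀ p, v = some p → p ∈ X := by
    rintro v hv p rfl
    exact hV (by simpa [hA] using hv)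
  set f₁ : Option (Pt m) × Option (Pt m) →₀ ℝ :=
    ∑ e ∈ G.E, Finsupp.single (some e.1, some e.2) (G.w e) with hf₁
  set f₂ : Option (Pt m) × Option (Pt m) →₀ ℝ :=
    ∑ z ∈ a.support, Finsupp.single (none, some z) (a z) with hf₂
  have hf₁0 : ∀ e, 0 ≤ f₁ e := sum_single_nonneg _ _ hw
  have hf₂0 : ∀ e, 0 ≤ f₂ e := sum_single_nonneg _ _ fun z _ => ha z
  have hsupp : ∀ e ∈ (f₁ + f₂).support,
      (∃ p ∈ G.V, ∃ q ∈ G.V, e = (some p, some q)) ∨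
        ∃ i, x i ∈ G.V ∧ e = (none, some (x i)) := by
    intro e he
    rcases Finset.mem_union.1 (Finsupp.support_add he) with h | h
    · obtain ⟨e', he', h⟩ := Finset.mem_biUnion.1 (Finsupp.support_finsetSum h)
      exact Or.inl ⟨e'.1, (hE e' he').1, e'.2, (hE e' he').2.1,
        Finset.mem_singleton.1 (Finsupp.support_single_subset h)⟩
    · obtain ⟨z, hz, h⟩ := Finset.mem_biUnion.1 (Finsupp.support_finsetSum h)
      obtain ⟨i, rfl⟩ := hax hz
      exact Or.inr ⟨i, haV _ hz, Finset.mem_singleton.1 (Finsupp.support_single_subset h)⟩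
  have hdiv : divergence (f₁ + f₂) =
      Finsupp.single none 1 - ∑ j, Finsupp.single (some (y j)) (n j) := by
    have hmass' : ∑ z ∈ a.support, a z = 1 := hmass
    ext v
    simp only [hf₁, hf₂, map_add, map_sum, divergence_single, Finsupp.add_apply,
      Finsupp.sub_apply, Finsupp.finsetSum_apply, Finset.sum_sub_distrib]
    cases v with
    | none => simp [hmass']
    | some z =>
      have h1 := hbal z
      have h2 : ∑ z' ∈ a.support, Finsupp.single (some z') (a z') (some z) = a z := by
        simp only [Finsupp.single_apply, Option.some.injEq]
        rw [Finset.sum_ite_eq']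
        split_ifs with h
        · rfl
        · exact (Finsupp.notMem_support_iff.1 h).symm
      have h3 : ∑ j, Finsupp.single (some (y j)) (n j) (some z) = bMeas y n z := by
        simp only [bMeas, Finsupp.finsetSum_apply, Finsupp.single_apply, Option.some.injEq]
      rw [h2, h3]
      simp only [WDG.outflow, WDG.inflow, Finset.sum_filter] at h1
      simp only [Finsupp.single_apply, Option.some.injEq, reduceCtorEq, if_false,
        Finset.sum_const_zero]
      linarith
  have hcost : flowCost α extendedDist (f₁ + f₂) ≤ G.cost α := by
    refine (flowCost_add_le hα0 hα1 extendedDist_nonneg hf₁0 hf₂0).trans ?_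
    have h1 : flowCost α extendedDist f₁ ≤ G.cost α :=
      (flowCost_sum_le hα0 hα1 extendedDist_nonneg _ fun e he e' => by
        rw [Finsupp.single_apply]
        split_ifs
        exacts [hw e he, le_rfl]).trans
        (Finset.sum_le_sum fun e he => flowCost_single_le extendedDist_nonneg _ (hw e he))
    have h2 : flowCost α extendedDist f₂ ≤ 0 := by
      refine (flowCost_le_sum extendedDist_nonneg hf₂0 subset_rfl).trans
        (Finset.sum_nonpos fun e he => ?_)
      obtain ⟨z, -, h⟩ := Finset.mem_biUnion.1 (Finsupp.support_finsetSum he)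
      rw [Finset.mem_singleton.1 (Finsupp.support_single_subset h)]
      simp [extendedDist]
    linarith
  have hyV : ∀ j, y j ∈ G.V := by
    intro j
    refine hbV _ (Finsupp.mem_support_iff.2 (ne_of_gt ?_))
    rw [bMeas, Finsupp.finsetSum_apply]
    refine (hn j).trans_le ?_
    have := Finset.single_le_sum (f := fun i => Finsupp.single (y i) (n i) (y j))
      (fun i _ => by rw [Finsupp.single_apply]; split_ifs; exacts [(hn i).le, le_rfl])
      (Finset.mem_univ j)
    simpa using this
  have key := le_sum_add_flowCost hα0 hα1 (extendedDist_nonneg (m := m)) hn (s := none) (A := A)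
    (Finset.mem_insert_self _ _) (F := minDelivery X α x y n)
    (fun T v hv => ((hleast T v (hAX v hv)).1).nonneg fun j => (hn j).le)
    (fun v hv => (hleast ∅ v (hAX v hv)).2 (Delivery.empty v))
    (fun v hv T₁ T₂ hd => (hleast _ v (hAX v hv)).2 (by
      rw [Set.mem_ofPred_eq]
      convert Delivery.merge _ _ _ _ _ hd (hleast _ v (hAX v hv)).1 (hleast _ v (hAX v hv)).1))
    (f₁ + f₂) (fun e => add_nonneg (hf₁0 e) (hf₂0 e)) (fun e he => by
      rcases hsupp e he with ⟨p, hp, q, hq, rfl⟩ | ⟨i, hi, rfl⟩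
      exacts [⟨hsomeA hp, hsomeA hq⟩, ⟨Finset.mem_insert_self _ _, hsomeA hi⟩])
    (fun e he T => by
      rcases hsupp e he with ⟨p, hp, q, hq, rfl⟩ | ⟨i, hi, rfl⟩
      · exact (hleast T _ (hAX _ (hsomeA hp))).2
          (Delivery.move p q T _ (hV hq) (hleast T _ (hAX _ (hsomeA hq))).1)
      · simpa [extendedDist] using (hleast T none fun _ h => by cases h).2
          (Delivery.root i T _ (hleast T _ (hAX _ (hsomeA hi))).1))
    (fun j => some (y j)) (fun j => hsomeA (hyV j)) hdiv
  refine (key.trans (add_le_add_left (Finset.sum_nonpos fun v hv => ?_) _)).trans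
    (by rwa [zero_add])
  refine (hleast _ v (hAX v hv)).2 ?_
  by_cases hj : ∃ j, some (y j) = v
  · obtain ⟨j, rfl⟩ := hj
    rw [Set.mem_ofPred_eq]
    convert Delivery.leaf (X := X) (x := x) j using 1
    ext i
    simp [hyinj.eq_iff]
  · rw [Set.mem_ofPred_eq]
    convert Delivery.empty (X := X) (α := α) (x := x) (y := y) (n := n) v using 1
    ext i
    simpa using fun h => hj ⟨i, h⟩

lemma exists_optimalAllocPath (hXc : IsCompact X) (hα0 : 0 ≤ α) (hα1 : α ≤ 1)
    {x : Fin k → Pt m} (hx : ∀ i, x i ∈ X) {y : Fin ℓ → Pt m} (hyinj : Function.Injective y)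
    (hy : ∀ j, y j ∈ X) {n : Fin ℓ → ℝ} (hn : ∀ j, 0 < n j) (hnsum : ∑ j, n j = 1)
    (hk : 0 < k) : ∃ G : WDG m, IsOptimalAllocPath X α x y n G := by
  have hX : ∀ p : Pt m, none = some p → p ∈ X := fun _ h => by cases h
  have hn' : ∀ j, 0 ≤ n j := fun j => (hn j).le
  obtain ⟨c, hc⟩ := Delivery.exists_isLeast hXc hn' hk hx hy Finset.univ none hX
  obtain ⟨f, a, hf, hfX, ha, -, hax, hmass, hdiv, hcost⟩ :=
    Delivery.exists_flow hα0 hα1 hn' hx hc.1 hX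
  obtain ⟨G, hG, hGc⟩ := exists_transportPath_of_flow hα0 hα1 hf hfX (b := bMeas y n)
    ((hax rfl).trans (Set.range_subset_iff.2 hx))
    ((support_sum_single_subset _ _).trans (Set.range_subset_iff.2 hy)) hdiv
  refine ⟨G, ⟨a, ha, hax rfl, hmass.trans hnsum, hG⟩, fun G' hG' => ?_⟩
  have := minDelivery_le_cost hXc hα0 hα1 hx hyinj hy hn hk hG'
  rw [minDelivery, hc.csInf_eq] at this
  exact (hGc.trans hcost).trans this

end Allocation

/-- The minimum of `M_α` over allocation paths `Path[x,b]` is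
attained, and equals the attained minimum of `d_α(Σ_i m_i δ_(x_i), b)` over the
simplex `K = (m_1,…,m_k) ≥ 0, Σ m_i = 1`. -/
theorem stmt_4 {m k ℓ : ℕ} (X : Set (Pt m)) (hXc : IsCompact X) (hXconv : Convex ℝ X)
    (α : ℝ) (hα0 : 0 ≤ α) (hα1 : α < 1)
    (x : Fin k → Pt m) (hxinj : Function.Injective x) (hxX : ∀ i, x i ∈ X)
    (y : Fin ℓ → Pt m) (hyinj : Function.Injective y) (hyX : ∀ j, y j ∈ X)
    (n : Fin ℓ → ℝ) (hn : ∀ j, 0 < n j) (hnsum : ∑ j, n j = 1)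
    (hk : 0 < k) :
    ∃ G : WDG m, IsOptimalAllocPath X α x y n G ∧
      ∃ mv : Fin k → ℝ, (∀ i, 0 ≤ mv i) ∧ ∑ i, mv i = 1 ∧
        WDG.cost α G = dCost X α (∑ i, Finsupp.single (x i) (mv i)) (bMeas y n) ∧
        ∀ mv' : Fin k → ℝ, (∀ i, 0 ≤ mv' i) → ∑ i, mv' i = 1 →
          dCost X α (∑ i, Finsupp.single (x i) (mv i)) (bMeas y n) ≤
            dCost X α (∑ i, Finsupp.single (x i) (mv' i)) (bMeas y n) := by
  obtain ⟨G, hG, hopt⟩ := exists_optimalAllocPath hXc hα0 hα1.le hxX hyinj hyX hn hnsum hk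
  obtain ⟨a, ha, hax, hmass, hGa⟩ := hG
  have hbdd : ∀ a', BddBelow (WDG.cost α '' {G : WDG m | IsTransportPath X G a' (bMeas y n)}) :=
    fun a' => ⟨0, by rintro _ ⟨G', hG', rfl⟩; exact cost_nonneg hG'.1⟩
  have haeq := eq_sum_single_of_support_subset hxinj hax
  have hasum : ∑ i, a (x i) = 1 := by rw [← massOf_sum_single, ← haeq, hmass]
  have hle : ∀ mv' : Fin k → ℝ, (∀ i, 0 ≤ mv' i) → ∑ i, mv' i = 1 →
      WDG.cost α G ≤ dCost X α (∑ i, Finsupp.single (x i) (mv' i)) (bMeas y n) := by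
    intro mv' hmv' hsum'
    obtain ⟨G₀, hG₀⟩ := exists_transportPath hα0 hα1.le hxX hyX hmv' (fun j => (hn j).le)
      (hsum'.trans hnsum.symm) hk
    refine le_csInf ⟨_, G₀, hG₀, rfl⟩ ?_
    rintro _ ⟨G', hG', rfl⟩
    exact hopt G' ⟨_, sum_single_nonneg _ _ fun i _ => hmv' i, support_sum_single_subset _ _,
      (massOf_sum_single _ _ _).trans hsum', hG'⟩
  have heq : WDG.cost α G = dCost X α (∑ i, Finsupp.single (x i) (a (x i))) (bMeas y n) :=
    le_antisymm (hle _ (fun i => ha _) hasum) (by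
      rw [← haeq]
      exact csInf_le (hbdd a) ⟨G, hGa, rfl⟩)
  exact ⟨G, ⟨⟨a, ha, hax, hmass, hGa⟩, hopt⟩, fun i => a (x i), fun i => ha _, hasum, heq,
    fun mv' hmv' hsum' => heq ▸ hle mv' hmv' hsum'⟩

end
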